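/- arXiv:1010.2312 — 4 statements merged into one kernel-verified Lean document; each statement's English description precedes it below -/
import Mathlib

section
/- Consider 4 students i1,…,i4 and 4 schools s1,…,s4 with strict preferences i1: s1≻s4≻s2≻s3; i2: s2≻s4≻s3≻s1; i3: s3≻s4≻s2≻s1; i4: s1≻s2≻s3≻s4, and strict priorities s1: i1≻i2≻i3≻i4; s2: i2≻i3≻i4≻i1; s3: i3≻i4≻i1≻i2; s4: i4≻i1≻i2≻i3. Then: (a) the matching M with M(i_k) = s_k for k = 1,…,4 is the unique stable matching; (b) the preference profile has rank 2 and is rank-compatible (the matching i1→s4, i2→s2, i3→s3, i4→s1 is rank-compatible); (c) M assigns student i4 her 4th-ranked school, so M is not rank-compatible. -/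
/-- Student preferences: `P3 i s` is student `i`'s ranking of school `s`.
i1: s1≻s4≻s2≻s3; i2: s2≻s4≻s3≻s1; i3: s3≻s4≻s2≻s1; i4: s1≻s2≻s3≻s4. -/
def P3 : Fin 4 → Fin 4 → ℕ :=
  ![![1, 3, 4, 2],
    ![4, 1, 3, 2],
    ![4, 3, 1, 2],
    ![1, 2, 3, 4]]

/-- School priorities: `Pi3 s i` is student `i`'s priority number at school `s`.
s1: i1≻i2≻i3≻i4; s2: i2≻i3≻i4≻i1; s3: i3≻i4≻i1≻i2; s4: i4≻i1≻i2≻i3. -/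
def Pi3 : Fin 4 → Fin 4 → ℕ :=
  ![![1, 2, 3, 4],
    ![4, 1, 2, 3],
    ![3, 4, 1, 2],
    ![2, 3, 4, 1]]

/-- (a) the identity matching (i_k → s_k) is the unique stable matching;
(b) the profile has rank 2 and the matching (i1→s4, i2→s2, i3→s3, i4→s1) is
rank-compatible, so the profile is rank-compatible;
(c) in the identity matching student i4 receives her 4th-ranked school, so the
unique stable matching is not rank-compatible. -/
theorem stable_not_rank_compatible_example :
    -- (a) identity is stable
    (¬ ∃ i s j, (Equiv.refl (Fin 4)) j = s ∧ (Equiv.refl (Fin 4)) i ≠ s ∧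
        P3 i s < P3 i ((Equiv.refl (Fin 4)) i) ∧ Pi3 s i < Pi3 s j) ∧
    -- (a) every stable matching is the identity
    (∀ M : Equiv (Fin 4) (Fin 4),
      (¬ ∃ i s j, M j = s ∧ M i ≠ s ∧ P3 i s < P3 i (M i) ∧ Pi3 s i < Pi3 s j) →
      M = Equiv.refl (Fin 4)) ∧
    -- (b) the profile has rank 2 ...
    ((∀ s, ∃ i, P3 i s ≤ 2) ∧ ¬ (∀ s, ∃ i, P3 i s ≤ 1)) ∧
    -- (b) ... and is rank-2-compatible via the explicit matching swapping i1 and i4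
    (∀ i, P3 i ((Equiv.swap (0 : Fin 4) 3) i) ≤ 2) ∧
    -- (c) i4 receives her 4th choice under the identity, which is not rank-compatible
    (P3 3 ((Equiv.refl (Fin 4)) 3) = 4) ∧
    ¬ (∀ i, P3 i ((Equiv.refl (Fin 4)) i) ≤ 2) := by
  refine ⟨by decide, ?_, by decide, by decide, by decide, by decide⟩
  intro M h
  have key : ∀ k : Fin 4, (∀ s, s ≠ k → P3 k k < P3 k s) →
      (∀ j, j ≠ k → Pi3 k k < Pi3 k j) → M k = k := by
    intro k h1 h2
    by_contra hk
    refine h ⟨k, k, M.symm k, M.apply_symm_apply k, hk, h1 _ hk, h2 _ ?_⟩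
    intro e
    exact hk ((M.symm_apply_eq.mp e).symm)
  have h0 := key 0 (by decide) (by decide)
  have h1 := key 1 (by decide) (by decide)
  have h2 := key 2 (by decide) (by decide)
  have h3 : M 3 = 3 := by
    have a0 : M 3 ≠ 0 := fun e => absurd (M.injective (e.trans h0.symm)) (by decide)
    have a1 : M 3 ≠ 1 := fun e => absurd (M.injective (e.trans h1.symm)) (by decide)
    have a2 : M 3 ≠ 2 := fun e => absurd (M.injective (e.trans h2.symm)) (by decide)
    generalize M 3 = x at a0 a1 a2 ⊢
    revert x
    decide
  ext i
  fin_cases i <;> simp [h0, h1, h2, h3]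
end

section
/- Let I and S have |I| = |S| = 4. For every mechanism 𝓜 (a function assigning to each pair consisting of a strict preference profile and a strict priority structure a matching) such that 𝓜 always outputs a stable matching, there exists an input pair (P, Π) with P rank-compatible such that the matching 𝓜(P, Π) is not rank-compatible. That is, no stable mechanism is rank-compatible. -/
/-- No stable mechanism is rank-compatible (for 4 students and 4 schools).
A mechanism takes a strict preference profile `φ` (each `φ i` injective with values
in `{1,…,4}`) and a strict priority structure `π` (each `π s` injective with values
in `{1,…,4}`) and outputs a matching.  If the mechanism always outputs a stable
matching, then there is an input whose preference profile is rank-compatible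
(with rank `n`) but whose output matching is not rank-compatible. -/
theorem no_stable_mechanism_rank_compatible
    (𝓜 : (Fin 4 → Fin 4 → ℕ) → (Fin 4 → Fin 4 → ℕ) → Equiv (Fin 4) (Fin 4))
    (hstable : ∀ φ π : Fin 4 → Fin 4 → ℕ,
      (∀ i, Function.Injective (φ i) ∧ ∀ s, 1 ≤ φ i s ∧ φ i s ≤ 4) →
      (∀ s, Function.Injective (π s) ∧ ∀ i, 1 ≤ π s i ∧ π s i ≤ 4) →
      ¬ ∃ i s j, (𝓜 φ π) j = s ∧ (𝓜 φ π) i ≠ s ∧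
          φ i s < φ i ((𝓜 φ π) i) ∧ π s i < π s j) :
    ∃ (φ π : Fin 4 → Fin 4 → ℕ) (n : ℕ),
      (∀ i, Function.Injective (φ i) ∧ ∀ s, 1 ≤ φ i s ∧ φ i s ≤ 4) ∧
      (∀ s, Function.Injective (π s) ∧ ∀ i, 1 ≤ π s i ∧ π s i ≤ 4) ∧
      -- n is the rank of φ : the least n ≥ 1 such that every school is ranked ≤ n by someone
      (1 ≤ n ∧ (∀ s, ∃ i, φ i s ≤ n) ∧
        ∀ k, 1 ≤ k → (∀ s, ∃ i, φ i s ≤ k) → n ≤ k) ∧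
      -- φ is rank-compatible
      (∃ M : Equiv (Fin 4) (Fin 4), ∀ i, φ i (M i) ≤ n) ∧
      -- but the mechanism's output is not rank-compatible
      ¬ (∀ i, φ i ((𝓜 φ π) i) ≤ n) := by
  have h1 : ∀ i, Function.Injective ((![![1,3,4,2], ![1,2,3,4], ![3,1,2,4], ![3,2,1,4]] :
      Fin 4 → Fin 4 → ℕ) i) ∧ ∀ s, 1 ≤ (![![1,3,4,2], ![1,2,3,4], ![3,1,2,4], ![3,2,1,4]] :
      Fin 4 → Fin 4 → ℕ) i s ∧ (![![1,3,4,2], ![1,2,3,4], ![3,1,2,4], ![3,2,1,4]] :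
      Fin 4 → Fin 4 → ℕ) i s ≤ 4 := by decide
  have h2 : ∀ s, Function.Injective ((fun _ => ![1,2,3,4] : Fin 4 → Fin 4 → ℕ) s) ∧
      ∀ i, 1 ≤ (fun _ => ![1,2,3,4] : Fin 4 → Fin 4 → ℕ) s i ∧
        (fun _ => ![1,2,3,4] : Fin 4 → Fin 4 → ℕ) s i ≤ 4 := by decide
  have hs := hstable _ _ h1 h2
  refine ⟨_, _, 2, h1, h2, ⟨by decide, by decide, ?_⟩, ?_, ?_⟩
  · intro k hk h
    obtain ⟨i, hi⟩ := h 3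
    refine le_trans ?_ hi
    clear hi
    revert i
    decide
  · exact ⟨⟨![3,0,1,2], ![1,2,3,0], by decide, by decide⟩, by decide⟩
  · generalize 𝓜 _ _ = M at hs ⊢
    intro hM
    have h0 : M 0 = 0 := by
      by_contra hne
      refine hs ⟨0, 0, M.symm 0, by simp, hne, ?_, ?_⟩
      · revert hne
        generalize M 0 = x
        revert x
        decide
      · have hj : M.symm 0 ≠ 0 := fun h => hne ((M.symm_apply_eq.mp h).symm)
        revert hj
        generalize M.symm 0 = x
        revert x
        decide
    have h3 := hM (M.symm 3)
    rw [Equiv.apply_symm_apply] at h3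
    have hj : M.symm 3 ≠ 0 := by
      intro h
      have := M.apply_symm_apply 3
      rw [h, h0] at this
      exact absurd this (by decide)
    revert hj h3
    generalize M.symm 3 = x
    revert x
    decide
end

section
/- Suppose the preference profile is rank-compatible with rank n. If a matching M satisfies ω(M) ≤ ω(M′) for every matching M′ (i.e., M minimizes the ω-index), then M is rank-compatible: φ_i(M(i)) ≤ n for every student i. -/
/-- Suppose the preference profile `φ` is rank-compatible with rank `n`.  If the
matching `M` minimizes the ω-index `ω(M) = Σ_i m^{φ i (M i)}` over all matchings,
then `M` is rank-compatible: `φ i (M i) ≤ n` for every student `i`. -/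
theorem omega_minimizer_rank_compatible {m n : ℕ} (hm : 0 < m)
    (φ : Fin m → Fin m → ℕ) (hφ : ∀ i s, 1 ≤ φ i s)
    (hrank : 1 ≤ n ∧ (∀ s, ∃ i, φ i s ≤ n) ∧
      ∀ k, 1 ≤ k → (∀ s, ∃ i, φ i s ≤ k) → n ≤ k)
    (hcompat : ∃ M : Equiv (Fin m) (Fin m), ∀ i, φ i (M i) ≤ n)
    (M : Equiv (Fin m) (Fin m))
    (hmin : ∀ M' : Equiv (Fin m) (Fin m),
      ∑ i, m ^ (φ i (M i)) ≤ ∑ i, m ^ (φ i (M' i))) :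
    ∀ i, φ i (M i) ≤ n := by
  intro i
  obtain ⟨M', hM'⟩ := hcompat
  by_contra hlt
  have hlt : n + 1 ≤ φ i (M i) := by omega
  rcases Nat.lt_or_ge 1 m with h2 | h1
  · have hub : ∑ j, m ^ (φ j (M' j)) ≤ m ^ (n + 1) := by
      calc ∑ j, m ^ (φ j (M' j)) ≤ ∑ _j : Fin m, m ^ n :=
            Finset.sum_le_sum (fun j _ => Nat.pow_le_pow_right hm (hM' j))
        _ = m ^ (n + 1) := by simp [pow_succ, mul_comm]
    haveI : Nontrivial (Fin m) := Fin.nontrivial_iff_two_le.mpr h2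
    obtain ⟨j, hj⟩ := exists_ne i
    have hlb : m ^ (φ i (M i)) < ∑ j, m ^ (φ j (M j)) :=
      Finset.single_lt_sum (f := fun j => m ^ (φ j (M j))) hj (Finset.mem_univ i)
        (Finset.mem_univ j) (Nat.pow_pos hm) (fun _ _ _ => Nat.zero_le _)
    have h3 : m ^ (n + 1) ≤ m ^ (φ i (M i)) := Nat.pow_le_pow_right hm hlt
    have h4 := hmin M'
    omega
  · have : m = 1 := by omega
    subst this
    have h5 := hM' i
    rw [Subsingleton.elim (M' i) (M i)] at h5
    omega
end

section
/- Consider 5 students i1,…,i5 and 5 schools s1,…,s5 with strict preferences i1: s1≻s2≻s3≻s4≻s5; i2: s2≻s3≻s4≻s5≻s1; i3: s3≻s4≻s5≻s1≻s2; i4: s4≻s5≻s1≻s2≻s3; i5: s1≻s2≻s5≻s3≻s4, and priorities s1: i1≻i5≻i2≻i3≻i4; s2: i5≻i3≻i2≻i1≻i4; s3: i3≻i1≻i2≻i4≻i5; s4: i4≻i3≻i2≻i1≻i5; s5: i1≻i5≻i2≻i3≻i4. Then: (a) the matching M* = (i1→s1, i2→s3, i3→s4, i4→s5, i5→s2) minimizes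 the ω-index (with ω(M*) = 105); (b) every ω-minimizing matching M′ has μ(M′) = 4, while the minimum of μ over all matchings is 2, so no ω-minimizing matching minimizes the preference index; (c) every ω-minimizing matching violates the priority of i3 for s3 (i2 occupies s3, i3 prefers s3 to its assignment, and s3 prioritizes i3 over i2), so no ω-minimizing matching is stable. -/
/-- Preferences: i1: s1≻s2≻s3≻s4≻s5; i2: s2≻s3≻s4≻s5≻s1; i3: s3≻s4≻s5≻s1≻s2;
i4: s4≻s5≻s1≻s2≻s3; i5: s1≻s2≻s5≻s3≻s4. -/
def P13 : Fin 5 → Fin 5 → ℕ :=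
  ![![1, 2, 3, 4, 5],
    ![5, 1, 2, 3, 4],
    ![4, 5, 1, 2, 3],
    ![3, 4, 5, 1, 2],
    ![1, 2, 4, 5, 3]]

/-- Priorities: s1: i1≻i5≻i2≻i3≻i4; s2: i5≻i3≻i2≻i1≻i4; s3: i3≻i1≻i2≻i4≻i5;
s4: i4≻i3≻i2≻i1≻i5; s5: i1≻i5≻i2≻i3≻i4. -/
def Pi13 : Fin 5 → Fin 5 → ℕ :=
  ![![1, 3, 4, 5, 2],
    ![4, 3, 2, 5, 1],
    ![2, 3, 1, 4, 5],
    ![4, 3, 2, 1, 5],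
    ![1, 3, 4, 5, 2]]

/-- The matching M* = (i1→s1, i2→s3, i3→s4, i4→s5, i5→s2). -/
def M13 : Equiv (Fin 5) (Fin 5) :=
  ⟨![0, 2, 3, 4, 1], ![0, 4, 1, 2, 3], by decide, by decide⟩

set_option synthInstance.maxSize 4000 in
set_option synthInstance.maxHeartbeats 400000 in
theorem key13 : ∀ a b : Fin 5, a ≠ b → ∀ c : Fin 5, a ≠ c → b ≠ c →
    ∀ d : Fin 5, a ≠ d → b ≠ d → c ≠ d →
    ∀ e : Fin 5, a ≠ e → b ≠ e → c ≠ e → d ≠ e →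
    105 ≤ 5 ^ P13 0 a + 5 ^ P13 1 b + 5 ^ P13 2 c + 5 ^ P13 3 d + 5 ^ P13 4 e ∧
    2 ≤ (P13 0 a - 1) + (P13 1 b - 1) + (P13 2 c - 1) + (P13 3 d - 1) + (P13 4 e - 1) ∧
    (5 ^ P13 0 a + 5 ^ P13 1 b + 5 ^ P13 2 c + 5 ^ P13 3 d + 5 ^ P13 4 e ≤ 105 →
      (P13 0 a - 1) + (P13 1 b - 1) + (P13 2 c - 1) + (P13 3 d - 1) + (P13 4 e - 1) = 4 ∧
      b = 2 ∧ c ≠ 2 ∧ P13 2 2 < P13 2 c) := by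
  decide +kernel

theorem key13' (M : Equiv (Fin 5) (Fin 5)) :
    105 ≤ ∑ i, 5 ^ (P13 i (M i)) ∧ 2 ≤ ∑ i, (P13 i (M i) - 1) ∧
    (∑ i, 5 ^ (P13 i (M i)) ≤ 105 → ∑ i, (P13 i (M i) - 1) = 4 ∧
      M 1 = 2 ∧ M 2 ≠ 2 ∧ P13 2 2 < P13 2 (M 2)) := by
  have h : ∀ i j : Fin 5, i ≠ j → M i ≠ M j := fun i j hij => M.injective.ne hij
  simp only [Fin.sum_univ_five]
  apply key13 <;> exact h _ _ (by decide)

/-- (a) `M13` minimizes the ω-index `ω(M) = Σ_i 5^{P13 i (M i)}`, with ω = 105;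
(b) every ω-minimizing matching has μ = 4, while the minimum of μ is 2 (attained
by the identity), so no ω-minimizing matching minimizes the preference index;
(c) every ω-minimizing matching violates the priority of i3 for s3 (with i2
occupying s3), so no ω-minimizing matching is stable. -/
theorem rank_based_hungarian_not_stable_not_mu_minimizing_example :
    -- (a)
    (∀ M' : Equiv (Fin 5) (Fin 5),
      ∑ i, 5 ^ (P13 i (M13 i)) ≤ ∑ i, 5 ^ (P13 i (M' i))) ∧
    (∑ i, 5 ^ (P13 i (M13 i)) = 105) ∧
    -- (b) every ω-minimizing matching has μ = 4
    (∀ M' : Equiv (Fin 5) (Fin 5),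
      (∀ M'' : Equiv (Fin 5) (Fin 5),
        ∑ i, 5 ^ (P13 i (M' i)) ≤ ∑ i, 5 ^ (P13 i (M'' i))) →
      ∑ i, (P13 i (M' i) - 1) = 4) ∧
    -- (b) the minimum of μ over all matchings is 2
    (∑ i, (P13 i ((Equiv.refl (Fin 5)) i) - 1) = 2) ∧
    (∀ M : Equiv (Fin 5) (Fin 5), 2 ≤ ∑ i, (P13 i (M i) - 1)) ∧
    -- (b) hence no ω-minimizing matching minimizes μ
    (∀ M' : Equiv (Fin 5) (Fin 5),
      (∀ M'' : Equiv (Fin 5) (Fin 5),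
        ∑ i, 5 ^ (P13 i (M' i)) ≤ ∑ i, 5 ^ (P13 i (M'' i))) →
      ¬ (∀ M'' : Equiv (Fin 5) (Fin 5),
        ∑ i, (P13 i (M' i) - 1) ≤ ∑ i, (P13 i (M'' i) - 1))) ∧
    -- (c) every ω-minimizing matching violates the priority of i3 for s3
    (∀ M' : Equiv (Fin 5) (Fin 5),
      (∀ M'' : Equiv (Fin 5) (Fin 5),
        ∑ i, 5 ^ (P13 i (M' i)) ≤ ∑ i, 5 ^ (P13 i (M'' i))) →
      (M' 1 = 2 ∧ M' 2 ≠ 2 ∧ P13 2 2 < P13 2 (M' 2) ∧ Pi13 2 2 < Pi13 2 1) ∧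
      ∃ i s j, M' j = s ∧ M' i ≠ s ∧ P13 i s < P13 i (M' i) ∧ Pi13 s i < Pi13 s j) := by
  have h1 : ∑ i, 5 ^ (P13 i (M13 i)) = 105 := by decide +kernel
  have h2 : ∑ i, (P13 i ((Equiv.refl (Fin 5)) i) - 1) = 2 := by decide +kernel
  refine ⟨fun M => h1.le.trans (key13' M).1, h1, fun M h => ?_, h2,
    fun M => (key13' M).2.1, fun M h h' => ?_, fun M h => ?_⟩
  · exact ((key13' M).2.2 ((h M13).trans h1.le)).1
  · have h3 := ((key13' M).2.2 ((h M13).trans h1.le)).1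
    have h4 := h' (Equiv.refl _)
    omega
  · obtain ⟨-, h3, h4, h5⟩ := (key13' M).2.2 ((h M13).trans h1.le)
    have h6 : Pi13 2 2 < Pi13 2 1 := by decide +kernel
    exact ⟨⟨h3, h4, h5, h6⟩, 2, 2, 1, h3, h4, h5, h6⟩
end
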